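/- arXiv:2605.16478 — 2 statements merged into one kernel-verified Lean document; each statement's English description precedes it below -/
import Mathlib

section
/- Let G be a finite group, H ≤ G a subgroup, and A a multiset of cardinality |G| all of whose elements lie in H. Then A is quotient-realizable in G if and only if A can be partitioned into [G:H] submultisets A₁, ..., A_{[G:H]}, each of cardinality |H|, such that each A_j is quotient-realizable in H. -/
/-- A multiset `A` of cardinality `|G|` with elements in a finite group `G` is
quotient-realizable in `G` if there are bijections `b, c : {1,…,|G|} → G` with
`A = {b(i)·c(i)⁻¹ : 1 ≤ i ≤ |G|}` as multisets. -/
def QuotientRealizable (G : Type*) [Group G] (A : Multiset G) : Prop :=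
  ∃ b c : Fin (Nat.card G) ≃ G,
    A = ↑(List.ofFn fun i => b i * (c i)⁻¹)

theorem quotientRealizable_iff_exists_perm {G : Type*} [Group G] [Fintype G] (A : Multiset G) :
    QuotientRealizable G A ↔ ∃ σ : Equiv.Perm G, A = ∑ g, {σ g * g⁻¹} := by
  have key (b c : Fin (Nat.card G) ≃ G) :
      (↑(List.ofFn fun i => b i * (c i)⁻¹) : Multiset G) = ∑ g, {(c.symm.trans b) g * g⁻¹} := by
    rw [← Fin.univ_val_map, ← Multiset.sum_map_singleton (Multiset.map _ _), Multiset.map_map]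
    exact Fintype.sum_equiv c _ _ fun i => by simp
  constructor
  · rintro ⟨b, c, rfl⟩
    exact ⟨c.symm.trans b, key b c⟩
  · rintro ⟨σ, rfl⟩
    let c := (Finite.equivFin G).symm
    refine ⟨c.trans σ, c, ?_⟩
    rw [key]
    simp

theorem exists_equiv_index_prod_subgroup {G : Type*} [Group G] [Finite G] (H : Subgroup G) :
    ∃ (r : Fin H.index → G) (e : Fin H.index × H ≃ G), ∀ j h, e (j, h) = h * r j := by
  obtain ⟨S, hS, -⟩ := H.exists_isComplement_right 1
  let f : Fin H.index ≃ S := (Finite.equivFinOfCardEq hS.card_right).symm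
  let m : H × S ≃ G := Equiv.ofBijective _ hS
  exact ⟨fun j => f j, ((f.prodCongr (Equiv.refl H)).trans (Equiv.prodComm _ _)).trans m,
    fun _ _ => rfl⟩

/-- A multiset supported in a subgroup `H ≤ G` is quotient-realizable in `G`
iff it can be partitioned into `[G:H]` submultisets of cardinality `|H|`, each
quotient-realizable in `H`. -/
theorem stmt5 {G : Type*} [Group G] [Finite G] (H : Subgroup G) (A : Multiset G)
    (hA : Multiset.card A = Nat.card G) (hsupp : ∀ a ∈ A, a ∈ H) :
    QuotientRealizable G A ↔
      ∃ B : Fin H.index → Multiset H,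
        A = ∑ j, (B j).map (fun h => (h : G)) ∧
        ∀ j, Multiset.card (B j) = Nat.card H ∧ QuotientRealizable H (B j) := by
  have := Fintype.ofFinite G
  have := Fintype.ofFinite H
  obtain ⟨r, e, he⟩ := exists_equiv_index_prod_subgroup H
  have map_coe (B : Multiset H) : B.map (fun h => (h : G)) = B.map H.subtype := by
    simp
  have sum_eq (σ : Equiv.Perm G) (τ : Fin H.index → Equiv.Perm H)
      (h : ∀ j (x : H), σ (x * r j) = τ j x * r j) :
      ∑ g, ({σ g * g⁻¹} : Multiset G) =
        ∑ j, (∑ x, ({τ j x * x⁻¹} : Multiset H)).map H.subtype := by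
    rw [← e.sum_comp, Fintype.sum_prod_type]
    refine Finset.sum_congr rfl fun j _ => ?_
    rw [← Multiset.coe_mapAddMonoidHom, map_sum]
    refine Finset.sum_congr rfl fun x _ => ?_
    simp [he, h, mul_assoc]
  simp only [quotientRealizable_iff_exists_perm, map_coe]
  constructor
  · rintro ⟨σ, rfl⟩
    have hσ (g : G) : σ g * g⁻¹ ∈ H :=
      hsupp _ (Multiset.mem_sum.2 ⟨g, Finset.mem_univ g, Multiset.mem_singleton_self _⟩)
    have hmem (j : Fin H.index) (x : H) : σ (x * r j) * (r j)⁻¹ ∈ H := by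
      simpa [mul_assoc] using H.mul_mem (hσ (x * r j)) x.2
    have hinj (j : Fin H.index) :
        Function.Injective fun x : H => (⟨σ (x * r j) * (r j)⁻¹, hmem j x⟩ : H) := by
      intro x y hxy
      simpa using hxy
    let τ (j : Fin H.index) : Equiv.Perm H :=
      Equiv.ofBijective _ (Finite.injective_iff_bijective.1 (hinj j))
    refine ⟨fun j => ∑ x, {τ j x * x⁻¹}, sum_eq σ τ fun j x => ?_, fun j => ⟨by simp, τ j, rfl⟩⟩
    simp [τ]
  · rintro ⟨B, rfl, hB⟩
    choose τ hτ using fun j => (hB j).2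
    refine ⟨(e.symm.trans (Equiv.prodShear (Equiv.refl _) τ)).trans e, ?_⟩
    simp only [hτ]
    refine (sum_eq _ τ fun j x => ?_).symm
    simp [← he]
end

section
/- Let G be a finite group, H ≤ G an abelian subgroup, and A a multiset of cardinality |G| all of whose elements lie in H. Then A is quotient-realizable in G if and only if A can be partitioned into [G:H] submultisets A₁, ..., A_{[G:H]}, each of cardinality |H|, such that for every j the product of all elements of A_j equals 1. -/
theorem exists_finset_separating {ι : Type*} [Fintype ι] [DecidableEq ι] (g : Equiv.Perm ι)
    {i j : ι} (hij : i ≠ j) :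
    ∃ S : Finset ι, j ∈ S ∧ i ∉ S ∧
      ((∀ x ∈ S, g x ∈ S) ∨ ∀ x ∈ S, Equiv.swap i j (g x) ∈ S) := by
  have hex : ∃ m, 0 < m ∧ ((g ^ m) j = i ∨ (g ^ m) j = j) :=
    ⟨orderOf g, orderOf_pos g, Or.inr (by simp [pow_orderOf_eq_one])⟩
  obtain ⟨hpos, hend⟩ := Nat.find_spec hex
  have hmin : ∀ k, 0 < k → k < Nat.find hex → (g ^ k) j ≠ i ∧ (g ^ k) j ≠ j := by
    intro k hk hlt
    have := Nat.find_min hex hlt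
    tauto
  generalize Nat.find hex = m at *
  refine ⟨(Finset.range m).image fun k => (g ^ k) j, ?_, ?_, ?_⟩
  · exact Finset.mem_image.2 ⟨0, Finset.mem_range.2 hpos, by simp⟩
  · simp only [Finset.mem_image, Finset.mem_range, not_exists, not_and]
    intro k hk
    rcases Nat.eq_zero_or_pos k with rfl | h0
    · simpa using hij.symm
    · exact (hmin k h0 hk).1
  · have hsucc : ∀ k, g ((g ^ k) j) = (g ^ (k + 1)) j := fun k => by
      rw [pow_succ', Equiv.Perm.mul_apply]
    have hzero : j ∈ (Finset.range m).image fun k => (g ^ k) j :=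
      Finset.mem_image.2 ⟨0, Finset.mem_range.2 hpos, by simp⟩
    rcases hend with hend | hend
    · right
      intro x hx
      obtain ⟨k, hk, rfl⟩ := Finset.mem_image.1 hx
      rw [hsucc]
      rcases (Nat.succ_le_of_lt (Finset.mem_range.1 hk)).eq_or_lt with h | h
      · rw [← Nat.succ_eq_add_one, h, hend, Equiv.swap_apply_left]
        exact hzero
      · obtain ⟨h1, h2⟩ := hmin (k + 1) k.succ_pos h
        rw [Equiv.swap_apply_of_ne_of_ne h1 h2]
        exact Finset.mem_image_of_mem _ (Finset.mem_range.2 h)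
    · left
      intro x hx
      obtain ⟨k, hk, rfl⟩ := Finset.mem_image.1 hx
      rw [hsucc]
      rcases (Nat.succ_le_of_lt (Finset.mem_range.1 hk)).eq_or_lt with h | h
      · rw [← Nat.succ_eq_add_one, h, hend]
        exact hzero
      · exact Finset.mem_image_of_mem _ (Finset.mem_range.2 h)

theorem exists_equiv_div_of_invariant {ι K : Type*} [Fintype ι] [DecidableEq ι] [CommGroup K]
    (b c : ι ≃ K) {i j : ι} (x : K) (g : Equiv.Perm ι)
    (hg : ∀ k, b (g k) = c i * c j * x / c k) (S : Finset ι) (hj : j ∈ S) (hi : i ∉ S)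
    (hS : ∀ k ∈ S, g k ∈ S) :
    ∃ b' c' : ι ≃ K, b' i / c' i = x ∧ ∀ k, k ≠ i → k ≠ j → b' k / c' k = b k / c k := by
  have hS' : ∀ k, g k ∈ S ↔ k ∈ S := fun k =>
    ⟨fun h => by simpa using Equiv.Perm.perm_symm_on_of_perm_on_finset hS h, hS k⟩
  let h : Equiv.Perm ι := Equiv.Perm.ofSubtype (g.subtypePerm (p := (· ∈ S)) hS')
  have h_mem : ∀ k ∈ S, h k = g k := fun k hk => by
    simp [h, Equiv.Perm.ofSubtype_apply_of_mem _ hk]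
  have h_notMem : ∀ k ∉ S, h k = k := fun k hk => Equiv.Perm.ofSubtype_apply_of_not_mem _ hk
  refine ⟨(Equiv.swap i j).trans (h.trans b), h.symm.trans c, ?_, ?_⟩
  · have : h.symm i = i := by rw [Equiv.symm_apply_eq, h_notMem i hi]
    simp only [Equiv.trans_apply, Equiv.swap_apply_left, this, h_mem j hj, hg]
    rw [div_div, mul_comm (c j) (c i), mul_div_cancel_left]
  · intro k hki hkj
    simp only [Equiv.trans_apply, Equiv.swap_apply_of_ne_of_ne hki hkj]
    by_cases hk : k ∈ S
    · have hk' : g.symm k ∈ S := by rw [← hS']; simpa using hk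
      have : h.symm k = g.symm k := by rw [Equiv.symm_apply_eq, h_mem _ hk']; simp
      have hb := hg (g.symm k)
      rw [Equiv.apply_symm_apply] at hb
      rw [this, h_mem k hk, hg, hb, div_div, div_div, mul_comm (c k)]
    · have : h.symm k = k := by rw [Equiv.symm_apply_eq, h_notMem k hk]
      rw [this, h_notMem k hk]

theorem exists_equiv_div_update {ι K : Type*} [Fintype ι] [DecidableEq ι] [CommGroup K]
    (b c : ι ≃ K) {i j : ι} (hij : i ≠ j) (x : K) :
    ∃ b' c' : ι ≃ K, b' i / c' i = x ∧ ∀ k, k ≠ i → k ≠ j → b' k / c' k = b k / c k := by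
  let g : Equiv.Perm ι := (c.trans (Equiv.divLeft (c i * c j * x))).trans b.symm
  have hg : ∀ k, b (g k) = c i * c j * x / c k := fun k => by simp [g]
  obtain ⟨S, hj, hi, hS | hS⟩ := exists_finset_separating g hij
  · exact exists_equiv_div_of_invariant b c x g hg S hj hi hS
  · obtain ⟨b', c', h1, h2⟩ := exists_equiv_div_of_invariant ((Equiv.swap i j).trans b) c x
      (g.trans (Equiv.swap i j)) (fun k => by simp [hg]) S hj hi hS
    refine ⟨b', c', h1, fun k hki hkj => ?_⟩
    rw [h2 k hki hkj, Equiv.trans_apply, Equiv.swap_apply_of_ne_of_ne hki hkj]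

/-- Hall's theorem: a family of `|K|` elements of a finite abelian group `K` with product `1` is
the pointwise quotient of two enumerations of `K`. -/
theorem exists_equiv_div_eq_of_prod_eq_one {ι K : Type*} [Fintype ι] [CommGroup K]
    (e : ι ≃ K) (a : ι → K) (ha : ∏ i, a i = 1) :
    ∃ b c : ι ≃ K, ∀ i, b i / c i = a i := by
  classical
  have : Fintype K := Fintype.ofEquiv ι e
  let j := e.symm 1
  have key : ∀ s : Finset ι, j ∉ s → ∃ b c : ι ≃ K, ∀ i ∈ s, b i / c i = a i := by
    intro s
    induction s using Finset.induction_on with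
    | empty => exact fun _ => ⟨e, e, by simp⟩
    | insert i s his ih =>
      intro hj
      rw [Finset.mem_insert, not_or] at hj
      obtain ⟨b, c, hbc⟩ := ih hj.2
      obtain ⟨b', c', h1, h2⟩ := exists_equiv_div_update b c (Ne.symm hj.1) (a i)
      refine ⟨b', c', fun k hk => ?_⟩
      rcases Finset.mem_insert.1 hk with rfl | hk
      · exact h1
      · rw [h2 k (fun h => his (h ▸ hk)) (fun h => hj.2 (h ▸ hk)), hbc k hk]
  obtain ⟨b, c, hbc⟩ := key (Finset.univ.erase j) (Finset.notMem_erase _ _)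
  refine ⟨b, c, fun i => ?_⟩
  by_cases hi : i = j
  · rw [← hi] at hbc
    have hprod : ∏ k, b k / c k = 1 := by
      rw [Finset.prod_div_distrib, Equiv.prod_comp b fun x => x, Equiv.prod_comp c fun x => x,
        div_self']
    rw [← ha, ← Finset.mul_prod_erase _ _ (Finset.mem_univ i),
      ← Finset.mul_prod_erase _ a (Finset.mem_univ i), Finset.prod_congr rfl hbc] at hprod
    exact mul_right_cancel hprod
  · exact hbc i (Finset.mem_erase.2 ⟨hi, Finset.mem_univ i⟩)

theorem Multiset.map_univ_equiv_comp {α β γ : Type*} [Fintype α] [Fintype β] (e : α ≃ β)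
    (F : β → γ) : (Finset.univ.val.map fun a => F (e a)) = Finset.univ.val.map F := by
  rw [← Multiset.map_univ_val_equiv e, Multiset.map_map]
  rfl

theorem quotientRealizable_iff_of_equiv {G ι : Type*} [Group G] [Fintype ι] (e : ι ≃ G)
    (A : Multiset G) :
    QuotientRealizable G A ↔
      ∃ b c : ι ≃ G, A = Finset.univ.val.map fun i => b i * (c i)⁻¹ := by
  have : Finite G := Finite.of_equiv ι e
  let f : Fin (Nat.card G) ≃ ι := (Finite.equivFin G).symm.trans e.symm
  have hmap : ∀ F : ι → G, Finset.univ.val.map F = ↑(List.ofFn fun k => F (f k)) := fun F => by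
    rw [← Multiset.map_univ_equiv_comp f, Fin.univ_val_map]
  constructor
  · rintro ⟨b, c, h⟩
    exact ⟨f.symm.trans b, f.symm.trans c, by rw [h, hmap]; simp⟩
  · rintro ⟨b, c, h⟩
    exact ⟨f.trans b, f.trans c, by rw [h, hmap]; rfl⟩

theorem Multiset.map_univ_prod {α β γ : Type*} [Fintype α] [Fintype β] (F : α × β → γ) :
    Finset.univ.val.map F = ∑ a, Finset.univ.val.map fun b => F (a, b) := by
  rw [← Finset.univ_product_univ, Finset.product_val]
  refine (Multiset.map_bind _ _ _).trans ?_
  simp only [Multiset.map_map, Function.comp_def]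
  rfl

theorem Subgroup.exists_equiv_fin_index_prod {G : Type*} [Group G] [Finite G] (H : Subgroup G) :
    ∃ (e : Fin H.index × H ≃ G) (r : Fin H.index → G), ∀ p, e p = p.2 * r p.1 := by
  obtain ⟨T, hT, -⟩ := H.exists_isComplement_right 1
  have f : Fin H.index ≃ T := by
    rw [← hT.card_right]
    exact (Finite.equivFin T).symm
  exact ⟨((f.prodCongr (Equiv.refl H)).trans (Equiv.prodComm _ _)).trans hT.equiv.symm,
    fun k => f k, fun p => rfl⟩

/-- For a multiset supported in an abelian subgroup `H ≤ G`, quotient-realizability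
in `G` is equivalent to a partition into `[G:H]` submultisets of cardinality `|H|`,
each with product `1`.  (Since the blocks are supported in the abelian subgroup `H`,
the product is independent of the chosen ordering.) -/
theorem stmt6 {G : Type*} [Group G] [Finite G] (H : Subgroup G)
    (hcomm : ∀ x ∈ H, ∀ y ∈ H, x * y = y * x)
    (A : Multiset G) (hA : Multiset.card A = Nat.card G) (hsupp : ∀ a ∈ A, a ∈ H) :
    QuotientRealizable G A ↔
      ∃ B : Fin H.index → Multiset G,
        A = ∑ j, B j ∧
        ∀ j, Multiset.card (B j) = Nat.card H ∧
          ∃ l : List G, B j = ↑l ∧ l.prod = 1 := by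
  let : CommGroup H :=
    { (inferInstance : Group H) with mul_comm := fun x y => Subtype.ext (hcomm x x.2 y y.2) }
  have : Fintype H := Fintype.ofFinite H
  obtain ⟨e, r, he⟩ := H.exists_equiv_fin_index_prod
  rw [quotientRealizable_iff_of_equiv e]
  constructor
  · rintro ⟨b, c, rfl⟩
    let q : Equiv.Perm (Fin H.index × H) := (e.trans b.symm).trans (c.trans e.symm)
    have hreindex : (Finset.univ.val.map fun i => b i * (c i)⁻¹) =
        Finset.univ.val.map fun p => e p * (e (q p))⁻¹ := by
      rw [← Multiset.map_univ_equiv_comp (e.trans b.symm)]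
      simp [q]
    rw [hreindex] at hsupp ⊢
    have hfst : ∀ p, (q p).1 = p.1 := by
      intro p
      have hmem : e p * (e (q p))⁻¹ ∈ H := hsupp _ (Multiset.mem_map_of_mem _ (Finset.mem_univ p))
      let z : H := (⟨_, hmem⟩ : H)⁻¹ * p.2
      have : e (p.1, z) = e (q p) := by
        rw [he (p.1, z)]
        simp [z, mul_assoc, ← he]
      rw [← e.injective this]
    let y : Fin H.index → H → H := fun j x => (q (j, x)).2
    have hy : ∀ j x, q (j, x) = (j, y j x) := fun j x => Prod.ext (hfst (j, x)) rfl
    have hval : ∀ j x, e (j, x) * (e (q (j, x)))⁻¹ = ((x / y j x : H) : G) := fun j x => by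
      rw [hy, he, he]; simp [div_eq_mul_inv]
    refine ⟨fun j => Finset.univ.val.map fun x : H => ((x / y j x : H) : G), ?_, fun j =>
      ⟨by simp, (Finset.univ.toList.map fun x : H => x / y j x).map H.subtype, ?_, ?_⟩⟩
    · rw [Multiset.map_univ_prod]
      simp only [hval]
    · rw [← Multiset.map_coe, ← Multiset.map_coe, Finset.coe_toList, Multiset.map_map]
      rfl
    · have hinj : Function.Injective (y j) := fun x x' h => by
        have : q (j, x) = q (j, x') := by rw [hy, hy, h]
        simpa using q.injective this
      rw [← map_list_prod, Finset.prod_map_toList, Finset.prod_div_distrib,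
        (Finite.injective_iff_bijective.1 hinj).prod_comp fun x => x, div_self', map_one]
  · rintro ⟨B, rfl, hB⟩
    have key : ∀ j, ∃ b c : H ≃ H, B j = Finset.univ.val.map fun x => ((b x / c x : H) : G) := by
      intro j
      obtain ⟨hcard, l, hl, hprod⟩ := hB j
      have hmem : ∀ x ∈ l, x ∈ H := fun x hx =>
        hsupp x (Multiset.mem_sum.2 ⟨j, Finset.mem_univ j, by rw [hl]; exact hx⟩)
      lift l to List H using hmem
      rw [hl, Multiset.coe_card, List.length_map] at hcard
      let f : H ≃ Fin l.length := (Finite.equivFin H).trans (finCongr hcard.symm)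
      have hmap : Finset.univ.val.map (fun x => l.get (f x)) = ↑l := by
        rw [Multiset.map_univ_equiv_comp f l.get, Fin.univ_val_map, List.ofFn_get]
      obtain ⟨b, c, hbc⟩ := exists_equiv_div_eq_of_prod_eq_one (Equiv.refl H)
        (fun x => l.get (f x)) (by
          rw [Finset.prod_eq_multiset_prod, hmap, Multiset.prod_coe]
          exact H.subtype_injective (by rw [map_list_prod, map_one]; exact hprod))
      refine ⟨b, c, ?_⟩
      simp only [hbc]
      rw [hl, ← Multiset.map_coe, ← hmap, Multiset.map_map]
      rfl
    choose b c hbc using key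
    refine ⟨(Equiv.prodShear (Equiv.refl _) b).trans e, (Equiv.prodShear (Equiv.refl _) c).trans e,
      ?_⟩
    rw [Multiset.map_univ_prod]
    refine Finset.sum_congr rfl fun j _ => ?_
    rw [hbc]
    simp [he, div_eq_mul_inv]
end
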